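/- Let (T,m) be a Noetherian local ring, R = T[x_1,…,x_n] a polynomial ring over T, I = (x_1,…,x_n)R, and P = m + I the homogeneous maximal ideal of R. Let f ∈ R be a homogeneous element such that the ideal C_f of T generated by the coefficients of f is m-primary. Then Supp_R H^n_I(R/fR) = {P}. -/

import Mathlib

open MvPolynomial

open CategoryTheory

universe u

namespace Koszul

variable {R : Type u} [CommRing R]

variable (R) in
/-- The degree `i` term of the Koszul complex on `k` elements of `R`. -/
def term : ℕ → ℕ → ModuleCat.{u} R
  | 0, 0 => ModuleCat.of R R
  | 0, _ + 1 => ModuleCat.of R PUnit.{u + 1}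
  | k + 1, 0 => term k 0
  | k + 1, i + 1 => ModuleCat.of R (term k (i + 1) × term k i)

/-- The differential of the Koszul complex on `y 0, …, y (k - 1)`: the complex on `k + 1` elements
is the cone of multiplication by `y k` on the complex on `k` elements. -/
def diff (y : ℕ → R) : ∀ k i, term R k (i + 1) →ₗ[R] term R k i
  | 0, _ => 0
  | k + 1, 0 => (diff y k 0).coprod (y k • LinearMap.id)
  | k + 1, i + 1 =>
      ((diff y k (i + 1)).coprod (y k • LinearMap.id)).prod (-(diff y k i ∘ₗ LinearMap.snd R _ _))

/-- The morphism of Koszul complexes from `c • y` to `y`. -/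
def scale (c : ℕ → R) : ∀ k i, term R k i →ₗ[R] term R k i
  | 0, _ => LinearMap.id
  | k + 1, 0 => scale c k 0
  | k + 1, i + 1 => (scale c k (i + 1)).prodMap (c k • scale c k i)

variable (R) in
/-- The degree zero term of a Koszul complex is the ring. -/
def bot : ∀ k, term R k 0 ≃ₗ[R] R
  | 0 => LinearEquiv.refl R R
  | k + 1 => bot k

variable (R) in
/-- The basis element of the top term of a Koszul complex. -/
def top : ∀ k, term R k k
  | 0 => (1 : R)
  | k + 1 => ((0 : term R k (k + 1)), top k)

theorem diff_zero (y : ℕ → R) (k : ℕ) (u : term R k 1) (v : term R k 0) :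
    diff y (k + 1) 0 (u, v) = diff y k 0 u + y k • v := rfl

theorem diff_succ (y : ℕ → R) (k i : ℕ) (u : term R k (i + 2)) (v : term R k (i + 1)) :
    diff y (k + 1) (i + 1) (u, v) = (diff y k (i + 1) u + y k • v, -diff y k i v) := rfl

theorem scale_succ (c : ℕ → R) (k i : ℕ) (u : term R k (i + 1)) (v : term R k i) :
    scale c (k + 1) (i + 1) (u, v) = (scale c k (i + 1) u, c k • scale c k i v) := rfl

theorem diff_diff (y : ℕ → R) (k i : ℕ) (x : term R k (i + 2)) :
    diff y k i (diff y k (i + 1) x) = 0 := by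
  induction k generalizing i with
  | zero => rfl
  | succ k ih =>
    obtain ⟨u, v⟩ := x
    rw [diff_succ]
    cases i with
    | zero => rw [diff_zero]; simp [ih]; rfl
    | succ i => rw [diff_succ]; simp only [map_add, ih, map_smul, map_neg]; simp; rfl

theorem scale_diff (y c : ℕ → R) (k i : ℕ) (x : term R k (i + 1)) :
    scale c k i (diff (fun j => c j * y j) k i x) = diff y k i (scale c k (i + 1) x) := by
  induction k generalizing i with
  | zero => rfl
  | succ k ih =>
    obtain ⟨u, v⟩ := x
    rw [scale_succ]
    cases i with
    | zero =>
      rw [diff_zero, diff_zero, ← ih]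
      change scale c k 0 _ = _
      simp [mul_smul, smul_comm (c k) (y k)]
    | succ i =>
      rw [diff_succ, diff_succ, scale_succ, ← ih, map_smul, ← ih]
      simp [mul_smul, smul_comm (c k) (y k)]
      rfl

theorem bot_scale (c : ℕ → R) (k : ℕ) (x : term R k 0) : bot R k (scale c k 0 x) = bot R k x := by
  induction k with
  | zero => rfl
  | succ k ih => exact ih x

instance free_term (k i : ℕ) : Module.Free R (term R k i) := by
  induction k generalizing i with
  | zero =>
    cases i
    · exact inferInstanceAs (Module.Free R R)
    · exact inferInstanceAs (Module.Free R PUnit.{u + 1})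
  | succ k ih =>
    cases i with
    | zero => exact ih 0
    | succ i => exact inferInstanceAs (Module.Free R (term R k (i + 1) × term R k i))

theorem subsingleton_term (k i : ℕ) (h : k < i) : Subsingleton (term R k i) := by
  induction k generalizing i with
  | zero =>
    obtain ⟨i, rfl⟩ := Nat.exists_eq_succ_of_ne_zero h.ne'
    exact inferInstanceAs (Subsingleton PUnit)
  | succ k ih =>
    obtain ⟨i, rfl⟩ := Nat.exists_eq_succ_of_ne_zero (show i ≠ 0 by lia)
    have := ih (i + 1) (by lia)
    have := ih i (by lia)
    exact inferInstanceAs (Subsingleton (term R k (i + 1) × term R k i))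

theorem exists_coord_top (k : ℕ) :
    ∃ τ : term R k k →ₗ[R] R, τ (top R k) = 1 ∧ ∀ x, x = τ x • top R k := by
  induction k with
  | zero => exact ⟨LinearMap.id, rfl, fun x => (mul_one (M := R) x).symm⟩
  | succ k ih =>
    obtain ⟨τ, h1, h⟩ := ih
    have := subsingleton_term (R := R) k (k + 1) (by lia)
    refine ⟨τ ∘ₗ LinearMap.snd R (term R k (k + 1)) (term R k k), h1, ?_⟩
    rintro ⟨u, v⟩
    exact Prod.ext (Subsingleton.elim _ _) (h v)

theorem scale_top (c : ℕ → R) (k : ℕ) :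
    scale c k k (top R k) = (∏ j ∈ Finset.range k, c j) • top R k := by
  induction k with
  | zero => simp [scale]
  | succ k ih =>
    have := subsingleton_term (R := R) k (k + 1) (by lia)
    refine Prod.ext (Subsingleton.elim _ _) ?_
    change c k • scale c k k (top R k) = (∏ j ∈ Finset.range (k + 1), c j) • top R k
    rw [ih, Finset.prod_range_succ, mul_comm, mul_smul]

/-- The ideal generated by `y 0, …, y (k - 1)`. -/
def ideal (y : ℕ → R) (k : ℕ) : Ideal R := Ideal.span (y '' Set.Iio k)

theorem ideal_succ (y : ℕ → R) (k : ℕ) : ideal y (k + 1) = ideal y k ⊔ Ideal.span {y k} := by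
  rw [ideal, ideal, ← Ideal.span_union, ← Set.image_singleton, ← Set.image_union]
  congr 2
  ext j
  simp

theorem map_diff_mem {M : Type*} [AddCommGroup M] [Module R M] (y : ℕ → R) (k i : ℕ)
    (g : term R k i →ₗ[R] M) (x : term R k (i + 1)) :
    g (diff y k i x) ∈ ideal y k • (⊤ : Submodule R M) := by
  induction k generalizing i with
  | zero => exact (congrArg (· ∈ _) (map_zero g)).mpr (zero_mem _)
  | succ k ih =>
    obtain ⟨u, v⟩ := x
    have hle : ideal y k • (⊤ : Submodule R M) ≤ ideal y (k + 1) • ⊤ :=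
      Submodule.smul_mono_left (ideal_succ y k ▸ le_sup_left)
    have hy (m : M) : y k • m ∈ ideal y (k + 1) • (⊤ : Submodule R M) :=
      Submodule.smul_mem_smul (Ideal.subset_span ⟨k, k.lt_succ_self, rfl⟩) trivial
    cases i with
    | zero =>
      rw [diff_zero]
      change g.comp (LinearMap.id : term R k 0 →ₗ[R] term R k 0) _ ∈ _
      rw [map_add, map_smul]
      exact add_mem (hle (ih _ _ _)) (hy _)
    | succ i =>
      rw [diff_succ]
      let gl := g ∘ₗ LinearMap.inl R (term R k (i + 1)) (term R k i)
      let gr := g ∘ₗ LinearMap.inr R (term R k (i + 1)) (term R k i)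
      have h : g (diff y k (i + 1) u + y k • v, -diff y k i v) =
          gl (diff y k (i + 1) u) + y k • gl v - gr (diff y k i v) := by
        rw [← map_smul gl, ← map_add gl, sub_eq_add_neg, ← map_neg gr]
        refine Eq.trans ?_ (map_add g _ _)
        congr 1
        exact Prod.ext (add_zero _).symm (zero_add _).symm
      exact h ▸ sub_mem (add_mem (hle (ih _ _ _)) (hy _)) (hle (ih _ _ _))

theorem exists_functional (y : ℕ → R) (k : ℕ) (j : ℕ) (hj : j < k + 1) :
    ∃ ψ : term R (k + 1) k →ₗ[R] R, ψ (diff y (k + 1) k (top R (k + 1))) = y j := by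
  induction k generalizing j with
  | zero =>
    obtain rfl : j = 0 := by lia
    refine ⟨LinearMap.id, ?_⟩
    change (0 : R) + y 0 * 1 = y 0
    simp
  | succ k ih =>
    rcases (show j < k + 1 ∨ j = k + 1 by lia) with h | rfl
    · obtain ⟨ψ, hψ⟩ := ih j h
      refine ⟨(-ψ) ∘ₗ LinearMap.snd R (term R (k + 1) (k + 1)) (term R (k + 1) k), ?_⟩
      rw [← hψ]
      change (-ψ) (-diff y (k + 1) k (top R (k + 1))) = _
      simp
    · obtain ⟨τ, h1, -⟩ := exists_coord_top (R := R) (k + 1)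
      refine ⟨τ ∘ₗ LinearMap.fst R (term R (k + 1) (k + 1)) (term R (k + 1) k), ?_⟩
      change τ (diff y (k + 1) (k + 1) 0 + y (k + 1) • top R (k + 1)) = _
      simp [h1]

theorem range_bot_diff (y : ℕ → R) (k : ℕ) (r : R) :
    r ∈ ideal y k ↔ ∃ x, bot R k (diff y k 0 x) = r := by
  induction k generalizing r with
  | zero =>
    simp [ideal, diff, eq_comm]
  | succ k ih =>
    rw [ideal_succ, Submodule.mem_sup]
    constructor
    · rintro ⟨a, ha, b, hb, rfl⟩
      obtain ⟨u, rfl⟩ := (ih a).1 ha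
      obtain ⟨v, rfl⟩ := Ideal.mem_span_singleton'.1 hb
      refine ⟨(u, (bot R k).symm v), ?_⟩
      rw [diff_zero]
      change bot R k _ = _
      simp [mul_comm]
    · rintro ⟨⟨u, v⟩, rfl⟩
      refine ⟨bot R k (diff y k 0 u), (ih _).2 ⟨u, rfl⟩, y k * bot R k v,
        Ideal.mul_mem_right _ _ (Ideal.mem_span_singleton_self _), ?_⟩
      rw [diff_zero]
      change _ = bot R k _
      simp

theorem exact_diff (y : ℕ → R) (k : ℕ)
    (hreg : ∀ j < k, ∀ r, y j * r ∈ ideal y j → r ∈ ideal y j) (i : ℕ) (x : term R k (i + 1))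
    (hx : diff y k i x = 0) : ∃ z, diff y k (i + 1) z = x := by
  induction k generalizing i with
  | zero => exact ⟨0, (subsingleton_term 0 (i + 1) i.succ_pos).elim _ _⟩
  | succ k ih =>
    have ih := ih fun j hj => hreg j (by lia)
    obtain ⟨u, v⟩ := x
    have key : diff y k i u + y k • v = 0 ∧ ∃ q, diff y k i q = v := by
      cases i with
      | zero =>
        rw [diff_zero] at hx
        refine ⟨hx, ?_⟩
        have h := (congrArg (bot R k) hx).trans (map_zero _)
        have hv : bot R k v ∈ ideal y k := by
          refine hreg k (by lia) _ ((range_bot_diff y k _).2 ⟨-u, ?_⟩)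
          simp only [map_add, map_smul, smul_eq_mul] at h
          simp only [map_neg]
          linear_combination -h
        obtain ⟨q, hq⟩ := (range_bot_diff y k _).1 hv
        exact ⟨q, (bot R k).injective hq⟩
      | succ i =>
        rw [diff_succ] at hx
        exact ⟨congrArg Prod.fst hx, ih i v (neg_eq_zero.1 (congrArg Prod.snd hx))⟩
    obtain ⟨h, q, rfl⟩ := key
    obtain ⟨p, hp⟩ := ih i (u + y k • q) (by rw [map_add, map_smul, h])
    refine ⟨(p, -q), ?_⟩
    rw [diff_succ, hp]
    simp
    rfl

/-- The Koszul complex on `y 0, …, y (k - 1)`. -/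
noncomputable def complex (y : ℕ → R) (k : ℕ) : ChainComplex (ModuleCat.{u} R) ℕ :=
  ChainComplex.of (term R k) (fun i => ModuleCat.ofHom (diff y k i)) fun i =>
    ModuleCat.hom_ext (LinearMap.ext (diff_diff y k i))

theorem complex_d (y : ℕ → R) (k i : ℕ) :
    (complex y k).d (i + 1) i = ModuleCat.ofHom (diff y k i) :=
  ChainComplex.of_d (term R k) (fun i => ModuleCat.ofHom (diff y k i)) i

/-- The augmentation of the Koszul complex. -/
noncomputable def augmentation (y : ℕ → R) (k : ℕ) :
    (complex y k).X 0 ⟶ ModuleCat.of R (R ⧸ ideal y k) :=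
  ModuleCat.ofHom ((ideal y k).mkQ ∘ₗ (bot R k).toLinearMap)

theorem d_comp_augmentation (y : ℕ → R) (k : ℕ) :
    (complex y k).d 1 0 ≫ augmentation y k = 0 := by
  rw [complex_d]
  ext x
  exact (Submodule.Quotient.mk_eq_zero _).2 ((range_bot_diff y k _).2 ⟨x, rfl⟩)

/-- The Koszul complex of a weakly regular sequence is a free resolution. -/
noncomputable def resolution (y : ℕ → R) (k : ℕ)
    (hreg : ∀ j < k, ∀ r, y j * r ∈ ideal y j → r ∈ ideal y j) :
    ProjectiveResolution (ModuleCat.of R (R ⧸ ideal y k)) where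
  complex := complex y k
  projective i := ModuleCat.projective_of_free (Module.Free.chooseBasis R (term R k i))
  π := (ChainComplex.toSingle₀Equiv _ _).symm ⟨augmentation y k, d_comp_augmentation y k⟩
  quasiIso := ⟨fun i => by
    cases i with
    | zero =>
      rw [ChainComplex.quasiIsoAt₀_iff, ShortComplex.quasiIso_iff_of_zeros']
      · refine (ShortComplex.exact_and_epi_g_iff_of_iso (S₂ := ShortComplex.mk _ _
          (d_comp_augmentation y k)) (ShortComplex.isoMk (Iso.refl _) (Iso.refl _) (Iso.refl _)
            ?_ ?_)).2 ⟨?_, ?_⟩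
        · exact (Category.id_comp _).trans (Category.comp_id _).symm
        · refine (Category.id_comp _).trans (Eq.trans ?_ (Category.comp_id _).symm)
          exact (ChainComplex.toSingle₀Equiv_symm_apply_f_zero _ (d_comp_augmentation y k)).symm
        · rw [ShortComplex.moduleCat_exact_iff]
          intro x hx
          obtain ⟨z, hz⟩ := (range_bot_diff y k _).1 ((Submodule.Quotient.mk_eq_zero _).1 hx)
          exact ⟨z, (congrArg (fun f => f.hom z) (complex_d y k 0)).trans
            ((bot R k).injective hz)⟩
        · exact (ModuleCat.epi_iff_surjective _).2
            ((Submodule.mkQ_surjective _).comp (bot R k).surjective)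
      all_goals rfl
    | succ i =>
      rw [quasiIsoAt_iff_exactAt' _ _ (ChainComplex.exactAt_succ_single_obj _ _)]
      rw [HomologicalComplex.exactAt_iff' _ (i + 1 + 1) (i + 1) i (by simp) (by simp)]
      rw [ShortComplex.moduleCat_exact_iff]
      dsimp only [HomologicalComplex.sc', HomologicalComplex.shortComplexFunctor']
      simp only [complex_d]
      exact exact_diff y k hreg i⟩

/-- The morphism of Koszul complexes from `c • y` to `y`. -/
noncomputable def scaleHom (y c : ℕ → R) (k : ℕ) :
    complex (fun j => c j * y j) k ⟶ complex y k where
  f i := ModuleCat.ofHom (scale c k i)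
  comm' i j h := by
    obtain rfl : j + 1 = i := h
    rw [complex_d, complex_d]
    ext x
    exact (scale_diff y c k j x).symm

theorem scaleHom_comp_π (y c : ℕ → R) (k : ℕ)
    (h : ∀ j < k, ∀ r, y j * r ∈ ideal y j → r ∈ ideal y j)
    (h' : ∀ j < k, ∀ r, (c j * y j) * r ∈ ideal (fun j => c j * y j) j →
      r ∈ ideal (fun j => c j * y j) j)
    (f : ModuleCat.of R (R ⧸ ideal (fun j => c j * y j) k) ⟶ ModuleCat.of R (R ⧸ ideal y k))
    (hf : ∀ r : R, f.hom (Submodule.Quotient.mk r) = Submodule.Quotient.mk r) :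
    (scaleHom y c k).f 0 ≫ (resolution y k h).π.f 0 = (resolution _ k h').π.f 0 ≫ f := by
  have h1 : (resolution y k h).π.f 0 = augmentation y k :=
    ChainComplex.toSingle₀Equiv_symm_apply_f_zero _ _
  have h2 : (resolution _ k h').π.f 0 = augmentation (fun j => c j * y j) k :=
    ChainComplex.toSingle₀Equiv_symm_apply_f_zero _ _
  rw [h1, h2]
  ext x
  change Submodule.Quotient.mk (bot R k (scale c k 0 x)) = f.hom (Submodule.Quotient.mk (bot R k x))
  rw [hf]
  exact congrArg _ (bot_scale c k x)

end Koszul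

namespace ChainComplex

open Limits

variable {D : Type*} [Category* D] [Abelian D]

/-- The inclusion of the homology in degree `n` into the term of degree `n`, when the differential
into that term vanishes. -/
noncomputable def topι (K : ChainComplex D ℕ) {n : ℕ} (h : K.d (n + 1) n = 0) :
    K.homology n ⟶ K.X n :=
  (K.isoHomologyπ (n + 1) n (by simp) h).inv ≫ K.iCycles n

instance mono_topι (K : ChainComplex D ℕ) {n : ℕ} (h : K.d (n + 1) n = 0) : Mono (topι K h) := by
  unfold topι
  infer_instance

theorem topι_comp (K : ChainComplex D ℕ) {n : ℕ} (h : K.d (n + 1) n = 0) (j : ℕ) :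
    topι K h ≫ K.d n j = 0 := by
  simp [topι]

theorem topι_exact (K : ChainComplex D ℕ) {n : ℕ} (h : K.d (n + 1) n = 0) (j : ℕ)
    (hj : (ComplexShape.down ℕ).next n = j) :
    (ShortComplex.mk _ _ (topι_comp K h j)).Exact := by
  apply ShortComplex.exact_of_f_is_kernel
  refine IsLimit.ofIsoLimit (K.cyclesIsKernel n j hj) ?_
  exact Fork.ext (K.isoHomologyπ (n + 1) n (by simp) h) (by simp [topι])

theorem topι_naturality {K L : ChainComplex D ℕ} {n : ℕ} (hK : K.d (n + 1) n = 0)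
    (hL : L.d (n + 1) n = 0) (φ : K ⟶ L) :
    HomologicalComplex.homologyMap φ n ≫ topι L hL = topι K hK ≫ φ.f n := by
  rw [← cancel_epi (K.isoHomologyπ (n + 1) n (by simp) hK).hom]
  simp [topι]

end ChainComplex

namespace CategoryTheory.ProjectiveResolution

open Limits

section

variable {C D : Type*} [Category* C] [Category* D] [Abelian C] [Abelian D] {X Y : C}

theorem map_d_eq_zero (P : ProjectiveResolution X) (F : C ⥤ D) [F.Additive] {n : ℕ}
    (h : IsZero (P.complex.X (n + 1))) :
    ((F.mapHomologicalComplex _).obj P.complex).d (n + 1) n = 0 :=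
  (F.map_isZero h).eq_of_src _ _

variable [HasProjectiveResolutions C]

/-- The inclusion of the top left derived functor into the top term of the complex computing it. -/
noncomputable def leftDerivedι (P : ProjectiveResolution X) (F : C ⥤ D) [F.Additive]
    {n : ℕ} (h : IsZero (P.complex.X (n + 1))) :
    (F.leftDerived n).obj X ⟶ F.obj (P.complex.X n) :=
  (P.isoLeftDerivedObj F n).hom ≫
    ChainComplex.topι ((F.mapHomologicalComplex _).obj P.complex) (P.map_d_eq_zero F h)

instance (P : ProjectiveResolution X) (F : C ⥤ D) [F.Additive]
    {n : ℕ} (h : IsZero (P.complex.X (n + 1))) : Mono (P.leftDerivedι F h) :=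
  have := ChainComplex.mono_topι _ (P.map_d_eq_zero F h)
  mono_comp' inferInstance this

theorem leftDerivedι_comp (P : ProjectiveResolution X) (F : C ⥤ D) [F.Additive]
    {n : ℕ} (h : IsZero (P.complex.X (n + 1))) (j : ℕ) :
    P.leftDerivedι F h ≫ F.map (P.complex.d n j) = 0 :=
  (Category.assoc _ _ _).trans ((congrArg (_ ≫ ·) (ChainComplex.topι_comp
    ((F.mapHomologicalComplex _).obj P.complex) _ j)).trans comp_zero)

theorem leftDerivedι_exact (P : ProjectiveResolution X) (F : C ⥤ D) [F.Additive]
    {n : ℕ} (h : IsZero (P.complex.X (n + 1))) (j : ℕ) (hj : (ComplexShape.down ℕ).next n = j) :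
    (ShortComplex.mk _ _ (P.leftDerivedι_comp F h j)).Exact :=
  (ShortComplex.exact_iff_of_iso (S₁ := ShortComplex.mk _ _ (P.leftDerivedι_comp F h j))
    (S₂ := ShortComplex.mk _ _ (ChainComplex.topι_comp
      ((F.mapHomologicalComplex _).obj P.complex) (P.map_d_eq_zero F h) j))
    (ShortComplex.isoMk (P.isoLeftDerivedObj F n) (Iso.refl _) (Iso.refl _)
      (Category.comp_id _).symm ((Category.id_comp _).trans (Category.comp_id _).symm))).2
    (ChainComplex.topι_exact _ _ j hj)

theorem leftDerivedι_naturality (P : ProjectiveResolution X) (Q : ProjectiveResolution Y)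
    (F : C ⥤ D) [F.Additive] {n : ℕ} (h : IsZero (P.complex.X (n + 1)))
    (h' : IsZero (Q.complex.X (n + 1))) (f : X ⟶ Y) (φ : P.complex ⟶ Q.complex)
    (comm : φ.f 0 ≫ Q.π.f 0 = P.π.f 0 ≫ f) :
    (F.leftDerived n).map f ≫ Q.leftDerivedι F h' = P.leftDerivedι F h ≫ F.map (φ.f n) := by
  have h1 := ChainComplex.topι_naturality (P.map_d_eq_zero F h) (Q.map_d_eq_zero F h')
    ((F.mapHomologicalComplex _).map φ)
  have h2 := isoLeftDerivedObj_hom_naturality f P Q φ comm F n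
  calc
    _ = ((F.leftDerived n).map f ≫ (Q.isoLeftDerivedObj F n).hom) ≫
          ChainComplex.topι _ (Q.map_d_eq_zero F h') := (Category.assoc _ _ _).symm
    _ = ((P.isoLeftDerivedObj F n).hom ≫
          (F.mapHomologicalComplex _ ⋙ HomologicalComplex.homologyFunctor _ _ n).map φ) ≫
          ChainComplex.topι _ (Q.map_d_eq_zero F h') := congrArg (· ≫ _) h2
    _ = _ := (Category.assoc _ _ _).trans
          ((congrArg (_ ≫ ·) h1).trans (Category.assoc _ _ _).symm)

end

section

variable {R : Type u} [CommRing R] {X Z : ModuleCat.{u} R}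

/-- The projection from cocycles to the top Ext module. -/
noncomputable def toExt (P : ProjectiveResolution X) (Y : ModuleCat.{u} R)
    {n : ℕ} (h : IsZero (P.complex.X (n + 1))) :
    (P.complex.X n ⟶ Y) →ₗ[R] ((Ext R (ModuleCat.{u} R) n).obj (Opposite.op X)).obj Y :=
  (P.leftDerivedι ((linearYoneda R (ModuleCat.{u} R)).obj Y).rightOp h).unop.hom

theorem toExt_surjective (P : ProjectiveResolution X) (Y : ModuleCat.{u} R)
    {n : ℕ} (h : IsZero (P.complex.X (n + 1))) : Function.Surjective (P.toExt Y h) :=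
  (ModuleCat.epi_iff_surjective
    (P.leftDerivedι ((linearYoneda R (ModuleCat.{u} R)).obj Y).rightOp h).unop).1 inferInstance

theorem toExt_eq_zero_iff (P : ProjectiveResolution X) (Y : ModuleCat.{u} R)
    {n : ℕ} (h : IsZero (P.complex.X (n + 1))) (j : ℕ) (hj : (ComplexShape.down ℕ).next n = j)
    (g : P.complex.X n ⟶ Y) : P.toExt Y h g = 0 ↔ ∃ g', P.complex.d n j ≫ g' = g := by
  have h1 := (P.leftDerivedι_exact
    ((linearYoneda R (ModuleCat.{u} R)).obj Y).rightOp h j hj).unop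
  have h2 := P.leftDerivedι_comp
    ((linearYoneda R (ModuleCat.{u} R)).obj Y).rightOp h j
  rw [ShortComplex.moduleCat_exact_iff] at h1
  constructor
  · exact h1 g
  · rintro ⟨g', rfl⟩
    exact congrArg (fun f => f.unop.hom g') h2

theorem ext_map_toExt (P : ProjectiveResolution X) (Q : ProjectiveResolution Z)
    (Y : ModuleCat.{u} R) {n : ℕ} (h : IsZero (P.complex.X (n + 1)))
    (h' : IsZero (Q.complex.X (n + 1))) (f : X ⟶ Z) (φ : P.complex ⟶ Q.complex)
    (comm : φ.f 0 ≫ Q.π.f 0 = P.π.f 0 ≫ f) (g : Q.complex.X n ⟶ Y) :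
    (((Ext R (ModuleCat.{u} R) n).map f.op).app Y).hom (Q.toExt Y h' g) =
      P.toExt Y h (φ.f n ≫ g) :=
  congrArg (fun f => f.unop.hom g) (P.leftDerivedι_naturality Q
    ((linearYoneda R (ModuleCat.{u} R)).obj Y).rightOp h h' f φ comm)

end

end CategoryTheory.ProjectiveResolution

namespace Koszul

variable {R : Type u} [CommRing R]

theorem isZero_complex (y : ℕ → R) (k : ℕ) : Limits.IsZero ((complex y k).X (k + 1)) :=
  have := subsingleton_term (R := R) k (k + 1) k.lt_succ_self
  ModuleCat.isZero_of_subsingleton (term R k (k + 1))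

variable (R) in
/-- The coordinate on the top term of a Koszul complex. -/
noncomputable def coord (k : ℕ) : term R k k →ₗ[R] R := (exists_coord_top k).choose

theorem coord_top (k : ℕ) : coord R k (top R k) = 1 := (exists_coord_top k).choose_spec.1

theorem smulRight_coord {M : Type*} [AddCommGroup M] [Module R M] (k : ℕ)
    (g : term R k k →ₗ[R] M) : (coord R k).smulRight (g (top R k)) = g := by
  ext x
  rw [LinearMap.smulRight_apply, ← map_smul]
  exact congrArg g ((exists_coord_top k).choose_spec.2 x).symm

/-- A Koszul complex on a weakly regular sequence of length `k` presents
`Ext ^ k (R ⧸ (y 0, …, y (k - 1)), M)` as a quotient of `M`. -/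
noncomputable def toExt (y : ℕ → R) (k : ℕ)
    (hreg : ∀ j < k, ∀ r, y j * r ∈ ideal y j → r ∈ ideal y j) (M : ModuleCat.{u} R) :
    M →ₗ[R] ((Ext R (ModuleCat.{u} R) k).obj (.op (ModuleCat.of R (R ⧸ ideal y k)))).obj M :=
  (resolution y k hreg).toExt M (isZero_complex y k) ∘ₗ
    { toFun m := ModuleCat.ofHom ((coord R k).smulRight m)
      map_add' a b := by ext x; exact smul_add _ _ _
      map_smul' a b := by ext x; exact smul_comm _ _ _ }

section

variable (y : ℕ → R) (k : ℕ)
    (hreg : ∀ j < k, ∀ r, y j * r ∈ ideal y j → r ∈ ideal y j) (M : ModuleCat.{u} R)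

theorem toExt_top (g : term R k k →ₗ[R] M) : toExt y k hreg M (g (top R k)) =
    (resolution y k hreg).toExt M (isZero_complex y k) (ModuleCat.ofHom g) := by
  change (resolution y k hreg).toExt M (isZero_complex y k)
    (ModuleCat.ofHom ((coord R k).smulRight (g (top R k)))) = _
  rw [smulRight_coord]

theorem toExt_surjective : Function.Surjective (toExt y k hreg M) := by
  intro e
  obtain ⟨g, rfl⟩ := (resolution y k hreg).toExt_surjective M (isZero_complex y k) e
  exact ⟨_, toExt_top y k hreg M g.hom⟩

theorem toExt_eq_zero_iff (m : M) :
    toExt y k hreg M m = 0 ↔ m ∈ ideal y k • (⊤ : Submodule R M) := by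
  have key (m : M) (j : ℕ) (hj : (ComplexShape.down ℕ).next k = j) : toExt y k hreg M m = 0 ↔
      ∃ g' : (complex y k).X j ⟶ M, g'.hom ((complex y k).d k j |>.hom (top R k)) = m := by
    refine ((resolution y k hreg).toExt_eq_zero_iff M (isZero_complex y k) j hj _).trans ?_
    refine exists_congr fun g' => ⟨fun h => ?_, fun h => ?_⟩
    · refine (congrArg (fun f => f.hom (top R k)) h).trans ?_
      change coord R k (top R k) • m = m
      rw [coord_top, one_smul]
    · subst h
      refine ModuleCat.hom_ext ?_
      exact (smulRight_coord k ((complex y k).d k j ≫ g').hom).symm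
  constructor
  · cases k with
    | zero =>
      intro h
      obtain ⟨g, rfl⟩ := (key m 0 (by simp)).1 h
      rw [HomologicalComplex.shape _ _ _ (by simp)]
      exact (congrArg (· ∈ _) (map_zero g.hom)).mpr (zero_mem _)
    | succ k =>
      intro h
      obtain ⟨g, rfl⟩ := (key m k (by simp)).1 h
      rw [complex_d]
      exact map_diff_mem y (k + 1) k g.hom _
  · intro h
    refine Submodule.smul_le (P := LinearMap.ker (toExt y k hreg M)).2 ?_ h
    intro r hr m _
    induction hr using Submodule.span_induction with
    | mem r hr =>
      obtain ⟨j, hj, rfl⟩ := hr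
      cases k with
      | zero => simp at hj
      | succ k =>
        obtain ⟨ψ, hψ⟩ := exists_functional y k j hj
        refine (key (y j • m) k (by simp)).2 ⟨ModuleCat.ofHom (ψ.smulRight m), ?_⟩
        rw [complex_d]
        exact congrArg (· • m) hψ
    | zero => rw [zero_smul]; exact zero_mem _
    | add a b _ _ ha hb => rw [add_smul]; exact add_mem ha hb
    | smul a b _ hb => rw [smul_assoc]; exact Submodule.smul_mem _ a hb

end

theorem ext_map_toExt (y z c : ℕ → R) (hc : ∀ j, z j = c j * y j) (k : ℕ) (M : ModuleCat.{u} R)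
    (h : ∀ j < k, ∀ r, y j * r ∈ ideal y j → r ∈ ideal y j)
    (h' : ∀ j < k, ∀ r, z j * r ∈ ideal z j → r ∈ ideal z j)
    (f : ModuleCat.of R (R ⧸ ideal z k) ⟶ ModuleCat.of R (R ⧸ ideal y k))
    (hf : ∀ r : R, f.hom (Submodule.Quotient.mk r) = Submodule.Quotient.mk r) (m : M) :
    (((Ext R (ModuleCat.{u} R) k).map f.op).app M).hom (toExt y k h M m) =
      toExt z k h' M ((∏ j ∈ Finset.range k, c j) • m) := by
  obtain rfl : z = fun j => c j * y j := funext hc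
  refine ((resolution _ k h').ext_map_toExt (resolution y k h) M (isZero_complex _ k)
    (isZero_complex y k) f (scaleHom y c k) (scaleHom_comp_π y c k h h' f hf) _).trans ?_
  refine (toExt_top _ k h' M ((coord R k).smulRight m ∘ₗ scale c k k)).symm.trans ?_
  rw [LinearMap.comp_apply, scale_top, map_smul, LinearMap.smulRight_apply, coord_top, one_smul]

end Koszul

namespace Koszul

open Limits Opposite

variable {R : Type u} [CommRing R]

theorem ideal_pow_anti (x : ℕ → R) (k : ℕ) : Antitone fun t => ideal (fun j => x j ^ t) k := by
  intro t s h
  refine Ideal.span_le.2 ?_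
  rintro _ ⟨j, hj, rfl⟩
  exact Ideal.pow_mem_of_pow_mem _ (m := t) (Ideal.subset_span ⟨j, hj, rfl⟩) h

/-- The diagram of the ideals generated by the powers of the terms of a sequence. -/
def powDiagram (x : ℕ → R) (k : ℕ) : ℕᵒᵖ ⥤ localCohomology.SelfLERadical (ideal x k) :=
  ObjectProperty.lift _
    { obj t := ideal (fun j => x j ^ t.unop) k
      map w := ⟨⟨ideal_pow_anti x k w.unop.down.down⟩⟩ : ℕᵒᵖ ⥤ Ideal R }
    fun t => Ideal.span_le.2 fun _ hr => by
      obtain ⟨j, hj, rfl⟩ := hr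
      exact ⟨t.unop, Ideal.subset_span ⟨j, hj, rfl⟩⟩

theorem exists_ideal_pow_le (x : ℕ → R) (k : ℕ) (J : Ideal R) (h : ideal x k ≤ J.radical) :
    ∃ t, ideal (fun j => x j ^ t) k ≤ J := by
  have h' (j : ℕ) (hj : j < k) : ∃ t, x j ^ t ∈ J := h (Ideal.subset_span ⟨j, hj, rfl⟩)
  choose! t ht using h'
  refine ⟨(Finset.range k).sup t, Ideal.span_le.2 ?_⟩
  rintro _ ⟨j, hj, rfl⟩
  exact Ideal.pow_mem_of_pow_mem _ (ht j hj) (Finset.le_sup (f := t) (Finset.mem_range.2 hj))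

instance initial_powDiagram (x : ℕ → R) (k : ℕ) : (powDiagram x k).Initial where
  out J := by
    apply +allowSynthFailures zigzag_isConnected
    · obtain ⟨t, ht⟩ := exists_ideal_pow_le x k J.1 J.2
      exact ⟨CostructuredArrow.mk (⟨⟨⟨ht⟩⟩⟩ : (powDiagram x k).obj (op t) ⟶ J)⟩
    · intro j₁ j₂
      apply Relation.ReflTransGen.single
      rcases le_total (unop j₁.left) (unop j₂.left) with h | h
      · right; exact ⟨CostructuredArrow.homMk (homOfLE h).op rfl⟩
      · left; exact ⟨CostructuredArrow.homMk (homOfLE h).op rfl⟩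

/-- Local cohomology supported in the ideal generated by a sequence, as a colimit over the ideals
generated by the powers of the terms. -/
noncomputable def localCohomologyIso [IsNoetherianRing R] (x : ℕ → R) (k i : ℕ) :
    localCohomology.ofDiagram.{u, 0}
      (powDiagram x k ⋙ localCohomology.selfLERadicalDiagram (ideal x k)) i ≅
      localCohomology (ideal x k) i :=
  localCohomology.isoOfFinal.{u, u, 0} (powDiagram x k)
    (localCohomology.selfLERadicalDiagram (ideal x k)) i ≪≫
    localCohomology.isoSelfLERadical (ideal x k) i

theorem exists_toLocalCohomology [IsNoetherianRing R] (x : ℕ → R) (k : ℕ) (M : ModuleCat.{u} R)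
    (hreg : ∀ t, ∀ j < k, ∀ r, x j ^ t * r ∈ ideal (fun j => x j ^ t) j →
      r ∈ ideal (fun j => x j ^ t) j) :
    ∃ φ : ℕ → M →ₗ[R] (localCohomology (ideal x k) k).obj M,
      (∀ h, ∃ t m, φ t m = h) ∧
      ∀ t m, φ t m = 0 ↔ ∃ s, t ≤ s ∧ ((∏ j ∈ Finset.range k, x j) ^ (s - t)) • m ∈
        ideal (fun j => x j ^ s) k • (⊤ : Submodule R M) := by
  let F := localCohomology.diagram
    (powDiagram x k ⋙ localCohomology.selfLERadicalDiagram (ideal x k)) k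
  have := localCohomology.hasColimitDiagram.{u, 0}
    (powDiagram x k ⋙ localCohomology.selfLERadicalDiagram (ideal x k)) k
  have := preservesSmallestFilteredColimits_of_preservesFilteredColimits (forget (ModuleCat.{u} R))
  let G := F ⋙ (evaluation _ _).obj M
  let c := ((evaluation _ _).obj M).mapCocone (colimit.cocone F)
  have hc : IsColimit c := isColimitOfPreserves ((evaluation _ _).obj M) (colimit.isColimit F)
  let e : c.pt ≅ (localCohomology (ideal x k) k).obj M := (localCohomologyIso x k k).app M
  let τ (t : ℕ) : M →ₗ[R] G.obj (op (op t)) := toExt _ k (hreg t) M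
  have hmap (t s : ℕ) (f : op (op t) ⟶ op (op s)) (m : M) :
      (G.map f).hom (τ t m) = τ s (((∏ j ∈ Finset.range k, x j) ^ (s - t)) • m) := by
    rw [← Finset.prod_pow]
    refine ext_map_toExt (fun j => x j ^ t) (fun j => x j ^ s) (fun j => x j ^ (s - t)) ?_ k M
      (hreg t) (hreg s) _ (fun r => rfl) m
    intro j
    rw [← pow_add, Nat.sub_add_cancel f.unop.unop.down.down]
  refine ⟨fun t => e.hom.hom ∘ₗ (c.ι.app (op (op t))).hom ∘ₗ τ t, fun h => ?_, fun t m => ?_⟩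
  · obtain ⟨⟨⟨t⟩⟩, z, hz⟩ := Concrete.isColimit_exists_rep G hc (e.inv.hom h)
    obtain ⟨m, rfl⟩ := toExt_surjective _ k (hreg t) M z
    refine ⟨t, m, ?_⟩
    refine (congrArg e.hom.hom hz).trans ?_
    exact congrArg (fun f => f.hom h) e.inv_hom_id
  · have he : Function.Injective e.hom.hom :=
      Function.LeftInverse.injective (g := e.inv.hom) fun z =>
        congrArg (fun f => f.hom z) e.hom_inv_id
    refine (map_eq_zero_iff _ he).trans ?_
    have hG := Concrete.isColimit_rep_eq_iff_exists G hc (τ t m) (0 : G.obj (op (op t)))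
    have h0 : (c.ι.app (op (op t))).hom (0 : G.obj (op (op t))) = 0 := map_zero _
    refine (Eq.congr_right h0).symm.trans (hG.trans ⟨?_, ?_⟩)
    · rintro ⟨⟨⟨s⟩⟩, f, g, hfg⟩
      refine ⟨s, f.unop.unop.down.down, ?_⟩
      rw [← toExt_eq_zero_iff _ k (hreg s) M]
      exact (hmap t s f m).symm.trans (hfg.trans (map_zero (G.map g).hom))
    · rintro ⟨s, hs, h⟩
      have w : (op (op t) : ℕᵒᵖᵒᵖ) ⟶ op (op s) := (homOfLE hs).op.op
      rw [← toExt_eq_zero_iff _ k (hreg s) M] at h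
      have h₁ : (G.map w).hom (τ t m) = 0 := (hmap t s w m).trans h
      have h₂ : (G.map w).hom 0 = 0 := map_zero (G.map w).hom
      exact ⟨op (op s), w, w, h₁.trans h₂.symm⟩

end Koszul

/-- If every element of a finitely generated module `N` is multiplied into `Q • N` by a power of
`a`, where `Q` consists of elements that are nilpotent on `N`, then `a` is nilpotent on `N`. -/
theorem Submodule.mem_radical_annihilator_of_pow_smul_mem {T B : Type*} [CommRing T]
    [IsNoetherianRing T] [AddCommGroup B] [Module T B] {s : Set B} (hs : s.Finite) {Q : Ideal T}
    (hQ : Q ≤ (span T s).annihilator.radical) {a : T}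
    (h : ∀ z ∈ span T s, ∃ k, a ^ k • z ∈ Q • span T s) :
    a ∈ (span T s).annihilator.radical := by
  set N := span T s
  obtain ⟨M, hM⟩ := Ideal.exists_pow_le_of_le_radical_of_fg hQ (IsNoetherian.noetherian Q)
  have key (M : ℕ) (z : B) (hz : z ∈ N) : ∃ k, a ^ k • z ∈ Q ^ M • N := by
    induction M with
    | zero => exact ⟨0, by simpa using hz⟩
    | succ M ih =>
      obtain ⟨k, hk⟩ := ih
      suffices ∀ w ∈ Q ^ M • N, ∃ l, a ^ l • w ∈ Q ^ (M + 1) • N by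
        obtain ⟨l, hl⟩ := this _ hk
        exact ⟨l + k, by rwa [pow_add a, mul_smul]⟩
      intro w hw
      induction hw using Submodule.smul_induction_on' with
      | smul r hr w hw =>
        obtain ⟨l, hl⟩ := h w hw
        refine ⟨l, ?_⟩
        rw [smul_comm, pow_succ, mul_smul]
        exact smul_mem_smul hr hl
      | add w _ w' _ hw hw' =>
        obtain ⟨l, hl⟩ := hw
        obtain ⟨l', hl'⟩ := hw'
        refine ⟨l' + l, ?_⟩
        rw [smul_add]
        refine add_mem ?_ ?_
        · rw [pow_add a, mul_smul]; exact smul_mem _ _ hl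
        · rw [add_comm l', pow_add a, mul_smul]; exact smul_mem _ _ hl'
  have hzero (z : B) (hz : z ∈ N) : ∃ k, a ^ k • z = 0 := by
    obtain ⟨k, hk⟩ := key M z hz
    have : Q ^ M • N = ⊥ := eq_bot_iff.2 (N.annihilator_smul ▸ smul_mono_left hM)
    exact ⟨k, by rwa [this, mem_bot] at hk⟩
  choose! k hk using hzero
  refine ⟨hs.toFinset.sup k, mem_annihilator_span _ _ |>.2 fun ⟨z, hz⟩ => ?_⟩
  rw [← Nat.sub_add_cancel (Finset.le_sup (f := k) (hs.mem_toFinset.2 hz)), pow_add, mul_smul,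
    hk z (subset_span hz), smul_zero]

namespace MvPolynomial

/-- A homogeneous polynomial whose image in `B` vanishes has coefficients that are nilpotent on
the image of the degree `D` component, provided the monomials of degree `D` that do not vanish
in `B` are divisible by all monomials of degree `p`. -/
theorem coeff_mem_radical_annihilator {σ T B : Type*} [Finite σ] [CommRing T]
    [IsNoetherianRing T] [CommRing B] [Algebra T B] (ord : MonomialOrder σ)
    (φ : MvPolynomial σ T →ₐ[T] B) {f : MvPolynomial σ T} {p : ℕ} (hf : f.IsHomogeneous p)
    (hφ : φ f = 0) (D : ℕ)
    (hD : ∀ b : σ →₀ ℕ, b.degree = D → φ (monomial b 1) = 0 ∨ ∀ e : σ →₀ ℕ, e.degree = p → e ≤ b)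
    (e : σ →₀ ℕ) :
    coeff e f ∈ (Submodule.span T
      ((fun b => φ (monomial b 1)) '' {b : σ →₀ ℕ | b.degree = D})).annihilator.radical := by
  set s := (fun b => φ (monomial b 1)) '' {b : σ →₀ ℕ | b.degree = D}
  have hsfin : s.Finite := (Finsupp.finite_of_degree_eq D).image _
  set N := Submodule.span T s
  by_contra hne
  obtain ⟨e, he, hmax⟩ : ∃ e, coeff e f ∉ N.annihilator.radical ∧
      ∀ e', ord.toSyn e < ord.toSyn e' → coeff e' f ∈ N.annihilator.radical := by
    classical
    have hsupp (e) (h : coeff e f ∉ N.annihilator.radical) : e ∈ f.support :=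
      mem_support_iff.2 fun h0 => h (h0 ▸ zero_mem _)
    obtain ⟨e, he, h⟩ := Finset.exists_max_image
      {e ∈ f.support | coeff e f ∉ N.annihilator.radical} ord.toSyn
      ⟨e, Finset.mem_filter.2 ⟨hsupp e hne, hne⟩⟩
    refine ⟨e, (Finset.mem_filter.1 he).2, fun e' hlt => ?_⟩
    by_contra h'
    exact (h e' (Finset.mem_filter.2 ⟨hsupp e' h', h'⟩)).not_gt hlt
  have hdeg (e) (h : coeff e f ≠ 0) : e.degree = p := by
    rw [Finsupp.degree_eq_weight_one]; exact hf h
  have hep : e.degree = p := hdeg e fun h0 => he (h0 ▸ zero_mem _)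
  set Q := Ideal.span ((fun e => coeff e f) '' {e' | ord.toSyn e < ord.toSyn e'})
  have hQ : Q ≤ N.annihilator.radical := Ideal.span_le.2 <| by
    rintro _ ⟨e', h, rfl⟩; exact hmax e' h
  let S : Submodule T B :=
    { carrier := {z | ∃ k, coeff e f ^ k • z ∈ Q • N}
      zero_mem' := ⟨0, by simp⟩
      add_mem' := by
        rintro z z' ⟨k, hk⟩ ⟨k', hk'⟩
        refine ⟨k' + k, ?_⟩
        rw [smul_add]
        refine add_mem ?_ ?_
        · rw [pow_add, mul_smul]; exact Submodule.smul_mem _ _ hk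
        · rw [add_comm, pow_add, mul_smul]; exact Submodule.smul_mem _ _ hk'
      smul_mem' := by
        rintro c z ⟨k, hk⟩
        refine ⟨k, ?_⟩
        rw [smul_comm]
        exact Submodule.smul_mem _ _ hk }
  have hS (z) (h : coeff e f • z ∈ S) : z ∈ S := by
    obtain ⟨k, hk⟩ := h
    exact ⟨k + 1, by rwa [pow_succ, mul_smul]⟩
  refine he (Submodule.mem_radical_annihilator_of_pow_smul_mem hsfin hQ fun z hz => ?_)
  suffices ∀ b : σ →₀ ℕ, b.degree = D → φ (monomial b 1) ∈ S by
    refine (Submodule.span_le (p := S)).2 ?_ hz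
    rintro _ ⟨b, hb, rfl⟩
    exact this b hb
  intro b
  induction b using (InvImage.wf ord.toSyn (wellFounded_lt (α := ord.syn))).induction with
  | _ b ih =>
  intro hb
  obtain h0 | hle := hD b hb
  · rw [h0]; exact zero_mem S
  apply hS
  have hsum : φ (monomial (b - e) 1 * f) = 0 := by rw [map_mul, hφ, mul_zero]
  classical
  rw [f.as_sum, Finset.mul_sum, map_sum,
    ← Finset.add_sum_erase _ _ (mem_support_iff.2 fun h0 => he (h0 ▸ zero_mem _) : e ∈ f.support)]
    at hsum
  have hterm (e') : φ (monomial (b - e) 1 * monomial e' (coeff e' f)) =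
      coeff e' f • φ (monomial (b - e + e') 1) := by
    rw [monomial_mul, one_mul, ← map_smul, smul_monomial, smul_eq_mul, mul_one]
  rw [hterm, tsub_add_cancel_of_le (hle e hep), add_eq_zero_iff_eq_neg] at hsum
  rw [hsum]
  refine neg_mem (sum_mem fun e' he' => ?_)
  rw [hterm]
  have hne := Finset.ne_of_mem_erase he'
  have he'p := hdeg e' (mem_support_iff.1 (Finset.mem_of_mem_erase he'))
  have hdeg' : (b - e + e').degree = D := by
    have h := congrArg Finsupp.degree (tsub_add_cancel_of_le (hle e hep))
    rw [map_add] at h ⊢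
    omega
  rcases lt_or_gt_of_ne (ord.toSyn.injective.ne hne) with hlt | hlt
  · refine S.smul_mem _ (ih _ ?_ hdeg')
    change ord.toSyn _ < ord.toSyn _
    conv_rhs => rw [← tsub_add_cancel_of_le (hle e hep)]
    rw [map_add, map_add]
    exact add_lt_add_right hlt _
  · refine ⟨0, ?_⟩
    rw [pow_zero, one_smul]
    exact Submodule.smul_mem_smul (Ideal.subset_span ⟨e', hlt, rfl⟩)
      (Submodule.subset_span ⟨_, hdeg', rfl⟩)

variable {T : Type*} [CommRing T] (n : ℕ)

variable (T) in
/-- The variables of a polynomial ring, extended by zero to a sequence. -/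
noncomputable def varSeq (j : ℕ) : MvPolynomial (Fin n) T := if h : j < n then X ⟨j, h⟩ else 0

theorem ideal_varSeq_one : Koszul.ideal (varSeq T n) n = Ideal.span (Set.range X) := by
  refine congrArg Ideal.span (Set.ext fun r => ⟨?_, ?_⟩)
  · rintro ⟨j, hj, rfl⟩
    have hj' : j < n := hj
    exact ⟨⟨j, hj⟩, by simp [varSeq, hj']⟩
  · rintro ⟨i, rfl⟩
    exact ⟨i, i.2, dif_pos i.2⟩

theorem mem_ideal_varSeq_pow (t : ℕ) {k : ℕ} (hk : k ≤ n) (g : MvPolynomial (Fin n) T) :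
    g ∈ Koszul.ideal (fun j => varSeq T n j ^ t) k ↔
      ∀ b ∈ g.support, ∃ i : Fin n, i < k ∧ t ≤ b i := by
  have h : (fun j => varSeq T n j ^ t) '' Set.Iio k =
      (fun b => monomial b (1 : T)) '' ((fun i => Finsupp.single i t) '' {i : Fin n | i < k}) := by
    rw [Set.image_image]
    ext r
    constructor
    · rintro ⟨j, hj, rfl⟩
      have hjn : j < n := lt_of_lt_of_le hj hk
      refine ⟨⟨j, hjn⟩, hj, ?_⟩
      simp [varSeq, hjn, X_pow_eq_monomial]
    · rintro ⟨i, hi, rfl⟩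
      refine ⟨i, hi, ?_⟩
      simp [varSeq, X_pow_eq_monomial]
  rw [Koszul.ideal, h, mem_ideal_span_monomial_image]
  simp

theorem mem_ideal_of_varSeq_pow_mul_mem (t j : ℕ) (hj : j < n) (g : MvPolynomial (Fin n) T)
    (h : varSeq T n j ^ t * g ∈ Koszul.ideal (fun j => varSeq T n j ^ t) j) :
    g ∈ Koszul.ideal (fun j => varSeq T n j ^ t) j := by
  rw [mem_ideal_varSeq_pow n t hj.le] at h ⊢
  intro b hb
  obtain ⟨i, hi, hle⟩ := h (Finsupp.single ⟨j, hj⟩ t + b) (by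
    rw [varSeq, dif_pos hj, X_pow_eq_monomial, mem_support_iff, coeff_monomial_mul, one_mul]
    exact mem_support_iff.1 hb)
  refine ⟨i, hi, ?_⟩
  rwa [Finsupp.add_apply, Finsupp.single_eq_of_ne (by rintro rfl; exact hi.ne rfl), zero_add]
    at hle

theorem prod_varSeq_pow (d : ℕ) : (∏ j ∈ Finset.range n, varSeq T n j) ^ d =
    monomial (Finsupp.equivFunOnFinite.symm fun _ => d) 1 := by
  rw [Finset.prod_range, ← Finset.prod_pow]
  have (i : Fin n) : varSeq T n i = X i := dif_pos i.2
  simp only [this]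
  rw [monomial_eq, C_1, one_mul, Finsupp.prod_fintype _ _ (by simp)]
  simp

/-- A power of a coefficient of a homogeneous polynomial `f` multiplies some power of the product
of the variables into the ideal generated by `f` and large powers of the variables. -/
theorem exists_coeff_pow_mul_mem [IsNoetherianRing T] {f : MvPolynomial (Fin n) T} {p : ℕ}
    (hf : f.IsHomogeneous p) (e : Fin n →₀ ℕ) (t : ℕ) : ∃ N s, t ≤ s ∧
      C (coeff e f) ^ N * (∏ j ∈ Finset.range n, varSeq T n j) ^ (s - t) ∈
        Koszul.ideal (fun j => varSeq T n j ^ s) n ⊔ Ideal.span {f} := by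
  set s := p + n * t + t + 1 with hs
  set L := Koszul.ideal (fun j => varSeq T n j ^ s) n ⊔ Ideal.span {f}
  have hD (b : Fin n →₀ ℕ) (hb : b.degree = n * (s - t)) :
      Ideal.Quotient.mkₐ T L (monomial b 1) = 0 ∨ ∀ e : Fin n →₀ ℕ, e.degree = p → e ≤ b := by
    by_cases hbs : ∃ i, s ≤ b i
    · refine .inl <| Ideal.Quotient.eq_zero_iff_mem.2 <| Ideal.mem_sup_left ?_
      rw [mem_ideal_varSeq_pow n s le_rfl]
      obtain ⟨i, hi⟩ := hbs
      intro b' hb'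
      obtain rfl : b' = b := by simpa using support_monomial_subset hb'
      exact ⟨i, i.2, hi⟩
    · push Not at hbs
      refine .inr fun e he i => (Finsupp.le_degree i e).trans (he.trans_le ?_)
      rw [Finsupp.degree_eq_sum, ← Finset.add_sum_erase _ _ (Finset.mem_univ i)] at hb
      have := Finset.sum_le_card_nsmul (Finset.univ.erase i) b (s - 1) fun j _ => by
        have := hbs j; omega
      rw [Finset.card_erase_of_mem (Finset.mem_univ i), Finset.card_univ, Fintype.card_fin,
        smul_eq_mul] at this
      obtain ⟨n, rfl⟩ : ∃ n', n = n' + 1 := ⟨n - 1, by have := i.2; omega⟩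
      have h1 : s - t = (s - 1) - t + 1 := by omega
      obtain ⟨r, hr⟩ : ∃ r, s - 1 = r + t := ⟨s - 1 - t, by omega⟩
      rw [h1, hr] at hb
      rw [hr] at this
      simp only [Nat.add_sub_cancel] at this hb
      have h2 : r = p + (n + 1) * t := by omega
      nlinarith
  obtain ⟨N, hN⟩ := coeff_mem_radical_annihilator MonomialOrder.lex (Ideal.Quotient.mkₐ T L) hf
    (Ideal.Quotient.eq_zero_iff_mem.2 <| Ideal.mem_sup_right <| Ideal.mem_span_singleton_self f)
    (n * (s - t)) hD e
  refine ⟨N, s, by omega, ?_⟩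
  rw [← Ideal.Quotient.eq_zero_iff_mem, prod_varSeq_pow, ← C_pow, ← smul_eq_C_mul]
  refine Submodule.mem_annihilator.1 hN _ (Submodule.subset_span ⟨_, ?_, rfl⟩)
  change Finsupp.degree _ = _
  rw [Finsupp.degree_eq_sum]
  simp

/-- If all coefficients of `f` are nonunits of a local ring, then products of the variables are
nonzero modulo `f` and larger powers of the variables. -/
theorem prod_varSeq_pow_notMem [IsLocalRing T] {f : MvPolynomial (Fin n) T}
    (hf : ∀ e, coeff e f ∈ IsLocalRing.maximalIdeal T) (t : ℕ) :
    (∏ j ∈ Finset.range n, varSeq T n j) ^ t ∉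
      Koszul.ideal (fun j => varSeq T n j ^ (t + 1)) n ⊔ Ideal.span {f} := by
  intro h
  have hf0 : map (IsLocalRing.residue T) f = 0 := by
    ext e
    rw [coeff_map, coeff_zero]
    exact (IsLocalRing.residue_eq_zero_iff _).2 (hf e)
  have h' := Ideal.mem_map_of_mem (map (IsLocalRing.residue T)) h
  have hle : (Koszul.ideal (fun j => varSeq T n j ^ (t + 1)) n ⊔ Ideal.span {f}).map
      (map (IsLocalRing.residue T)) ≤
      Koszul.ideal (fun j => varSeq (IsLocalRing.ResidueField T) n j ^ (t + 1)) n := by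
    rw [Ideal.map_sup, Koszul.ideal, Ideal.map_span, Ideal.map_span, sup_le_iff, Ideal.span_le,
      Ideal.span_le]
    constructor
    · rintro _ ⟨_, ⟨j, hj, rfl⟩, rfl⟩
      refine Ideal.subset_span ⟨j, hj, ?_⟩
      have hj' : j < n := hj
      simp [varSeq, hj']
    · rintro _ ⟨_, rfl, rfl⟩
      rw [hf0]
      exact zero_mem _
  have h'' := hle h'
  rw [prod_varSeq_pow, map_monomial, map_one, mem_ideal_varSeq_pow n _ le_rfl] at h''
  obtain ⟨i, -, hi⟩ := h'' _ (by
    classical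
    exact mem_support_iff.2 ((coeff_monomial _ _ _).trans_ne
      (by rw [if_pos rfl]; exact one_ne_zero)))
  simp at hi

end MvPolynomial

theorem Ideal.Quotient.mk_mem_smul_top_iff {R : Type*} [CommRing R] (I J : Ideal R) (r : R) :
    (Submodule.Quotient.mk r : R ⧸ I) ∈ J • (⊤ : Submodule R (R ⧸ I)) ↔ r ∈ J ⊔ I := by
  have h : J • (⊤ : Submodule R (R ⧸ I)) = Submodule.map (Submodule.mkQ I) J := by
    rw [← Submodule.range_mkQ I, ← Submodule.map_top, ← Submodule.map_smul'', smul_eq_mul,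
      Ideal.mul_top]
  rw [h, sup_comm, ← Submodule.comap_map_mkQ]
  rfl

namespace MvPolynomial

theorem isMaximal_map_maximalIdeal_sup {σ T : Type*} [CommRing T] [IsLocalRing T] :
    ((IsLocalRing.maximalIdeal T).map (C : T →+* MvPolynomial σ T) ⊔
      Ideal.span (Set.range X)).IsMaximal := by
  let ψ : MvPolynomial σ T →+* IsLocalRing.ResidueField T :=
    (IsLocalRing.residue T).comp constantCoeff
  have hψ : Function.Surjective ψ := IsLocalRing.residue_surjective.comp fun c =>
    ⟨C c, constantCoeff_C _ c⟩
  suffices h : (IsLocalRing.maximalIdeal T).map (C : T →+* MvPolynomial σ T) ⊔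
      Ideal.span (Set.range X) = RingHom.ker ψ from h ▸ RingHom.ker_isMaximal_of_surjective ψ hψ
  refine le_antisymm (sup_le (Ideal.map_le_iff_le_comap.2 fun c hc => ?_)
    (Ideal.span_le.2 ?_)) fun g hg => ?_
  · change IsLocalRing.residue T (constantCoeff (C c)) = 0
    rwa [constantCoeff_C, IsLocalRing.residue_eq_zero_iff]
  · rintro _ ⟨i, rfl⟩
    change IsLocalRing.residue T (constantCoeff (X i)) = 0
    rw [constantCoeff_X, map_zero]
  · have hg' : constantCoeff g ∈ IsLocalRing.maximalIdeal T :=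
      (IsLocalRing.residue_eq_zero_iff _).1 hg
    rw [← sub_add_cancel g (C (constantCoeff g))]
    refine add_mem (Ideal.mem_sup_right ?_) (Ideal.mem_sup_left (Ideal.mem_map_of_mem C hg'))
    rw [← Set.image_univ, mem_ideal_span_X_image]
    intro b hb
    by_contra! h0
    obtain rfl : b = 0 := Finsupp.ext fun i => h0 i (Set.mem_univ i)
    exact mem_support_iff.1 hb (by simp [constantCoeff_eq])

end MvPolynomial

/-- **Marley–Vassilev, Corollary 2.5.**
Let `(T, m)` be a Noetherian local ring, `R = T[x₁,…,xₙ]`, `I = (x₁,…,xₙ)R`, and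
`P = mR + I` the homogeneous maximal ideal of `R`.  If `f ∈ R` is homogeneous and the
ideal `C_f` of `T` generated by its coefficients is `m`-primary, then
`Supp_R Hⁿ_I(R/fR) = {P}`. -/
theorem support_top_localCohomology_eq_max
    {T : Type} [CommRing T] [IsLocalRing T] [IsNoetherianRing T]
    (n : ℕ) (f : MvPolynomial (Fin n) T) (p : ℕ) (hf : f.IsHomogeneous p)
    (hprim : (Ideal.span ((fun m => MvPolynomial.coeff m f) '' ↑f.support)).radical
        = IsLocalRing.maximalIdeal T) :
    letI R := MvPolynomial (Fin n) T
    letI I : Ideal R := Ideal.span (Set.range (X : Fin n → R))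
    letI P : Ideal R := (IsLocalRing.maximalIdeal T).map (C : T →+* R) ⊔ I
    Module.support R ((localCohomology I n).obj
        (ModuleCat.of (MvPolynomial (Fin n) T) (MvPolynomial (Fin n) T ⧸ Ideal.span {f})))
      = { Q : PrimeSpectrum (MvPolynomial (Fin n) T) | Q.asIdeal = P } := by
  have hlc := Koszul.exists_toLocalCohomology (varSeq T n) n
    (ModuleCat.of _ (MvPolynomial (Fin n) T ⧸ Ideal.span {f})) (mem_ideal_of_varSeq_pow_mul_mem n)
  rw [ideal_varSeq_one] at hlc
  set H := (localCohomology (Ideal.span (Set.range (X : Fin n → MvPolynomial (Fin n) T))) n).obj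
    (ModuleCat.of _ (MvPolynomial (Fin n) T ⧸ Ideal.span {f}))
  obtain ⟨φ, hsurj, hker⟩ := hlc
  have hX (h : H) (i : Fin n) : ∃ t, (X i : MvPolynomial (Fin n) T) ^ t • h = 0 := by
    obtain ⟨t, m, rfl⟩ := hsurj h
    refine ⟨t, ?_⟩
    rw [← map_smul, hker]
    refine ⟨t, le_rfl, Submodule.smul_mem _ _ (Submodule.smul_mem_smul ?_ trivial)⟩
    exact Ideal.subset_span ⟨i, i.2, by simp [varSeq]⟩
  have hC (h : H) (e : Fin n →₀ ℕ) :
      ∃ N, (C (coeff e f) : MvPolynomial (Fin n) T) ^ N • h = 0 := by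
    obtain ⟨t, m, rfl⟩ := hsurj h
    obtain ⟨g, rfl⟩ := Submodule.Quotient.mk_surjective _ m
    obtain ⟨N, s, hts, hmem⟩ := exists_coeff_pow_mul_mem n hf e t
    refine ⟨N, ?_⟩
    rw [← map_smul, hker]
    refine ⟨s, hts, (Ideal.Quotient.mk_mem_smul_top_iff _ _ (_ * (_ * g))).2 ?_⟩
    convert Ideal.mul_mem_right g _ hmem using 1
    ring
  have hcoeff (e) : coeff e f ∈ IsLocalRing.maximalIdeal T := by
    by_cases h0 : coeff e f = 0
    · rw [h0]; exact zero_mem _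
    · rw [← hprim]
      exact Ideal.le_radical (Ideal.subset_span ⟨e, mem_support_iff.2 h0, rfl⟩)
  have hsub (Q : PrimeSpectrum (MvPolynomial (Fin n) T))
      (hQ : Q ∈ Module.support (MvPolynomial (Fin n) T) H) :
      Q.asIdeal = (IsLocalRing.maximalIdeal T).map C ⊔ Ideal.span (Set.range X) := by
    obtain ⟨h, hh⟩ := Module.mem_support_iff_exists_annihilator.1 hQ
    refine (isMaximal_map_maximalIdeal_sup.eq_of_le Q.2.ne_top (sup_le ?_ ?_)).symm
    · rw [Ideal.map_le_iff_le_comap, ← hprim]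
      refine (Q.2.comap C).isRadical.radical_le_iff.2 (Ideal.span_le.2 ?_)
      rintro _ ⟨e, -, rfl⟩
      obtain ⟨N, hN⟩ := hC h e
      exact Q.2.mem_of_pow_mem N (hh (Submodule.mem_annihilator_span_singleton _ _ |>.2 hN))
    · rw [Ideal.span_le]
      rintro _ ⟨i, rfl⟩
      obtain ⟨t, ht⟩ := hX h i
      exact Q.2.mem_of_pow_mem t (hh (Submodule.mem_annihilator_span_singleton _ _ |>.2 ht))
  have hnontriv : Nontrivial H := by
    refine ⟨φ 1 (Submodule.Quotient.mk 1), 0, fun h0 => ?_⟩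
    obtain ⟨s, hs, hmem⟩ := (hker _ _).1 h0
    obtain ⟨d, rfl⟩ := Nat.exists_eq_add_of_le' hs
    refine prod_varSeq_pow_notMem n hcoeff d ?_
    have := (Ideal.Quotient.mk_mem_smul_top_iff _ _ (_ * 1)).1 hmem
    rwa [mul_one, Nat.add_sub_cancel] at this
  refine Set.Subset.antisymm hsub ?_
  obtain ⟨Q, hQ⟩ := Module.nonempty_support_of_nontrivial (R := MvPolynomial (Fin n) T) (M := H)
  intro Q' hQ'
  rwa [PrimeSpectrum.ext (hQ'.trans (hsub Q hQ).symm)]
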